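/- With k ≥ 5 and f_0, f_1, J = ℂ[y,z]f_0 + ℂ[y,z]f_1 as above (f_0 homogeneous of weight k+1, f_1 = D·f_0 of weight k+2, wt y = 1, wt z = 2), the quotient ℂ[y,z]/J is finite dimensional of dimension (k+1)(k+2)/2; moreover the weight-n component J_{(n)} satisfies: J_{(n)} = 0 for n ≤ k, dim J_{(n)} = n − k for k+1 ≤ n ≤ 2k+2, and J_{(n)} = ℂ[y,z]_{(n)} for n ≥ 2k+1. -/

import Mathlib

open MvPolynomial

/-- The operator `D = ((k+2)y² − 2kz) ∂/∂y + (3k+4) yz ∂/∂z` on `ℂ[y,z]`. -/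
noncomputable def D2 (k : ℂ) : MvPolynomial (Fin 2) ℂ → MvPolynomial (Fin 2) ℂ :=
  fun p => (C (k + 2) * X 0 ^ 2 - C (2 * k) * X 1) * pderiv 0 p
    + C (3 * k + 4) * X 0 * X 1 * pderiv 1 p

/-- `f₀(y,z) = Σⱼ (−1)ʲ (k+1)!/((k+1−2j)!(j!)²) y^{k+1−2j} zʲ`. -/
noncomputable def f0 (k : ℕ) : MvPolynomial (Fin 2) ℂ :=
  ∑ j ∈ Finset.range ((k + 1) / 2 + 1),
    C ((-1) ^ j * (Nat.factorial (k + 1) : ℂ) /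
      (Nat.factorial (k + 1 - 2 * j) * (Nat.factorial j) ^ 2)) *
    X 0 ^ (k + 1 - 2 * j) * X 1 ^ j

/-- The ideal `J = (f₀, f₁)` of `ℂ[y,z]`, where `f₁ = D f₀`. -/
noncomputable def Jideal (k : ℕ) : Ideal (MvPolynomial (Fin 2) ℂ) :=
  Ideal.span {f0 k, D2 (k : ℂ) (f0 k)}

/-- The weight-`n` component of `ℂ[y,z]` for the grading `wt y = 1`, `wt z = 2`. -/
noncomputable def Wt (n : ℕ) : Submodule ℂ (MvPolynomial (Fin 2) ℂ) :=
  weightedHomogeneousSubmodule ℂ (![1, 2] : Fin 2 → ℕ) n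

/-- Partial derivatives in `y` and `z` commute. -/
theorem pderiv_zero_one_comm (p : MvPolynomial (Fin 2) ℂ) :
    pderiv 0 (pderiv 1 p) = pderiv 1 (pderiv 0 p) := by
  have h : ⁅pderiv (R := ℂ) (0 : Fin 2), pderiv (R := ℂ) (1 : Fin 2)⁆ = 0 := by
    apply MvPolynomial.derivation_ext
    intro i
    fin_cases i <;> simp [Derivation.commutator_apply, pderiv_X]
  have h2 := congrArg (fun D => D p) h
  simpa [Derivation.commutator_apply, sub_eq_zero] using h2

theorem euler_of_isWeightedHomogeneous {p : MvPolynomial (Fin 2) ℂ} {n : ℕ}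
    (h : p.IsWeightedHomogeneous (![1, 2] : Fin 2 → ℕ) n) :
    X 0 * pderiv 0 p + 2 * (X 1 * pderiv 1 p) = (n : MvPolynomial (Fin 2) ℂ) * p := by
  simpa [Fin.sum_univ_two, nsmul_eq_mul] using h.sum_weight_X_mul_pderiv

/-- A weighted homogeneous solution of `p_yy + z p_zz + p_z = 0` that, together with its first
partial derivatives, is divisible by a prime `d` not dividing `z (y² + 4z)` vanishes. -/
theorem eq_zero_of_prime_dvd_pderiv {d : MvPolynomial (Fin 2) ℂ} (hd : Prime d)
    (hz : ¬ d ∣ X 1) (hu : ¬ d ∣ X 0 ^ 2 + 4 * X 1) (n : ℕ) :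
    ∀ p : MvPolynomial (Fin 2) ℂ, p.IsWeightedHomogeneous (![1, 2] : Fin 2 → ℕ) n →
      pderiv 0 (pderiv 0 p) = -(X 1 * pderiv 1 (pderiv 1 p) + pderiv 1 p) →
      d ∣ p → d ∣ pderiv 0 p → d ∣ pderiv 1 p → p = 0 := by
  have h2 : IsUnit (2 : MvPolynomial (Fin 2) ℂ) := by
    have : (2 : MvPolynomial (Fin 2) ℂ) = C 2 := (map_ofNat C 2).symm
    rw [this]
    exact (IsUnit.mk0 (2 : ℂ) two_ne_zero).map C
  have hd2 : ¬ d ∣ 2 := fun h => hd.not_isUnit (isUnit_of_dvd_unit h h2)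
  induction n with
  | zero =>
    intro p hp _ hdp _ _
    by_contra h0
    have : p = C (coeff 0 p) := by
      have h := weightedHomogeneousComponent_zero (w := (![1, 2] : Fin 2 → ℕ)) p
        (by intro i; fin_cases i <;> simp)
      rw [hp.weightedHomogeneousComponent_same] at h
      exact h
    have hc : coeff 0 p ≠ 0 := by
      intro hc
      rw [hc, C_0] at this
      exact h0 this
    rw [this] at hdp
    exact hd.not_isUnit (isUnit_of_dvd_unit hdp ((IsUnit.mk0 _ hc).map C))
  | succ n ih =>
    intro p hp hpde hdp hdy hdz
    have hE := euler_of_isWeightedHomogeneous hp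
    have hEy := congrArg (pderiv 0) hE
    have hEz := congrArg (pderiv 1) hE
    simp only [map_add, Derivation.leibniz, pderiv_X_self, smul_eq_mul,
      pderiv_X_of_ne (show (1 : Fin 2) ≠ 0 by decide),
      pderiv_X_of_ne (show (0 : Fin 2) ≠ 1 by decide), Derivation.map_natCast,
      show (2 : MvPolynomial (Fin 2) ℂ) = ((2 : ℕ) : MvPolynomial (Fin 2) ℂ) by norm_cast]
      at hEy hEz
    rw [pderiv_zero_one_comm] at hEy
    push_cast at hEy hEz hE
    have hpy : (pderiv 0 p).IsWeightedHomogeneous (![1, 2] : Fin 2 → ℕ) n := hp.pderiv rfl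
    have hpdey := congrArg (pderiv 0) hpde
    simp only [map_add, map_neg, Derivation.leibniz, smul_eq_mul,
      pderiv_X_of_ne (show (1 : Fin 2) ≠ 0 by decide), pderiv_zero_one_comm] at hpdey
    obtain ⟨a, ha⟩ := hdy
    obtain ⟨b, hb⟩ := hdz
    have hzz : d ∣ pderiv 1 (pderiv 1 p) := by
      have h : d ∣ X 1 * ((X 0 ^ 2 + 4 * X 1) * pderiv 1 (pderiv 1 p)) := by
        refine ⟨(2 * X 1 * ((n : MvPolynomial (Fin 2) ℂ) - 1) - X 0 ^ 2) * b
          - (n : MvPolynomial (Fin 2) ℂ) * X 0 * a, ?_⟩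
        linear_combination (2 * X 1) * hEz - X 0 * hEy + X 0 ^ 2 * hpde
          + (2 * X 1 * (n - 1) - X 0 ^ 2) * hb - n * X 0 * ha
      exact ((hd.dvd_or_dvd ((hd.dvd_or_dvd h).resolve_left hz)).resolve_left hu)
    have hyy : d ∣ pderiv 0 (pderiv 0 p) := by
      rw [hpde]
      exact (dvd_add (hzz.mul_left _) ⟨b, hb⟩).neg_right
    have hyz : d ∣ pderiv 1 (pderiv 0 p) := by
      have h : d ∣ 2 * (X 1 * pderiv 1 (pderiv 0 p)) := by
        have e : 2 * (X 1 * pderiv 1 (pderiv 0 p))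
          = (n : MvPolynomial (Fin 2) ℂ) * pderiv 0 p - X 0 * pderiv 0 (pderiv 0 p) := by
          linear_combination hEy
        rw [e]
        exact dvd_sub (Dvd.dvd.mul_left ⟨a, ha⟩ _) (hyy.mul_left _)
      exact ((hd.dvd_or_dvd ((hd.dvd_or_dvd h).resolve_left hd2)).resolve_left hz)
    have hy0 : pderiv 0 p = 0 := ih _ hpy (by linear_combination hpdey) ⟨a, ha⟩ hyy hyz
    simp only [hy0, map_zero] at hpde hE hEz
    have hN : ((n : MvPolynomial (Fin 2) ℂ) + 1) ≠ 0 := by exact_mod_cast Nat.succ_ne_zero n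
    have hz0 : pderiv 1 p = 0 := by
      have : ((n : MvPolynomial (Fin 2) ℂ) + 1) * pderiv 1 p = 0 := by
        linear_combination -hEz + 2 * hpde
      exact (mul_eq_zero.mp this).resolve_left hN
    rw [hz0] at hE
    have : ((n : MvPolynomial (Fin 2) ℂ) + 1) * p = 0 := by linear_combination -hE
    exact (mul_eq_zero.mp this).resolve_left hN

theorem f0_isWeightedHomogeneous (k : ℕ) :
    (f0 k).IsWeightedHomogeneous (![1, 2] : Fin 2 → ℕ) (k + 1) := by
  refine IsWeightedHomogeneous.sum _ _ _ fun j hj => ?_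
  have hj' : 2 * j ≤ k + 1 := by have := Finset.mem_range.mp hj; omega
  have h0 := (isWeightedHomogeneous_X ℂ (![1, 2] : Fin 2 → ℕ) 0).pow (k + 1 - 2 * j)
  have h1 := (isWeightedHomogeneous_X ℂ (![1, 2] : Fin 2 → ℕ) 1).pow j
  have h := (h0.C_mul ((-1) ^ j * (Nat.factorial (k + 1) : ℂ) /
      (Nat.factorial (k + 1 - 2 * j) * (Nat.factorial j) ^ 2))).mul h1
  convert! h using 1
  simp
  omega

theorem pderiv_zero_term (c : ℂ) (a j : ℕ) :
    pderiv 0 (C c * (X 0 ^ a * X 1 ^ j) : MvPolynomial (Fin 2) ℂ) =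
      C (c * a) * (X 0 ^ (a - 1) * X 1 ^ j) := by
  simp
  ring

theorem pderiv_one_term (c : ℂ) (a j : ℕ) :
    pderiv 1 (C c * (X 0 ^ a * X 1 ^ j) : MvPolynomial (Fin 2) ℂ) =
      C (c * j) * (X 0 ^ a * X 1 ^ (j - 1)) := by
  simp
  ring

/-- The heat-type equation `∂²f₀/∂y² = -(z ∂²f₀/∂z² + ∂f₀/∂z)`. -/
theorem pderiv_pderiv_f0 (k : ℕ) :
    pderiv 0 (pderiv 0 (f0 k)) = -(X 1 * pderiv 1 (pderiv 1 (f0 k)) + pderiv 1 (f0 k)) := by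
  set c : ℕ → ℂ := fun j => (-1) ^ j * (Nat.factorial (k + 1) : ℂ) /
      (Nat.factorial (k + 1 - 2 * j) * (Nat.factorial j) ^ 2) with hc
  have hf : f0 k = ∑ j ∈ Finset.range ((k + 1) / 2 + 1),
      C (c j) * (X 0 ^ (k + 1 - 2 * j) * X 1 ^ j) := by
    simp only [f0, hc, mul_assoc]
  have hL : pderiv 0 (pderiv 0 (f0 k)) = ∑ j ∈ Finset.range ((k + 1) / 2 + 1),
      C (c j * ((k + 1 - 2 * j : ℕ) * (k + 1 - 2 * j - 1 : ℕ))) *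
        (X 0 ^ (k + 1 - 2 * j - 1 - 1) * X 1 ^ j) := by
    rw [hf, map_sum, map_sum]
    refine Finset.sum_congr rfl fun j _ => ?_
    simp only [pderiv_zero_term]
    rw [mul_assoc]
  have hR : X 1 * pderiv 1 (pderiv 1 (f0 k)) + pderiv 1 (f0 k)
      = ∑ j ∈ Finset.range ((k + 1) / 2 + 1),
      C (c j * (j : ℂ) ^ 2) * (X 0 ^ (k + 1 - 2 * j) * X 1 ^ (j - 1)) := by
    rw [hf, map_sum, map_sum, Finset.mul_sum, ← Finset.sum_add_distrib]
    refine Finset.sum_congr rfl fun j _ => ?_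
    simp only [pderiv_one_term]
    simp only [map_mul, map_pow, map_natCast]
    rcases j with _ | _ | j
    · simp
    · simp
    · simp only [Nat.add_sub_cancel]
      push_cast
      ring
  rw [hL, hR, Finset.sum_range_succ, Finset.sum_range_succ', neg_add, ← Finset.sum_neg_distrib]
  congr 1
  · refine Finset.sum_congr rfl fun j hj => ?_
    have hj' : 2 * (j + 1) ≤ k + 1 := by have := Finset.mem_range.mp hj; omega
    obtain ⟨m, hm⟩ := Nat.exists_eq_add_of_le hj'
    have e1 : k + 1 - 2 * j = m + 2 := by omega
    have e2 : k + 1 - 2 * (j + 1) = m := by omega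
    have e3 : c j * (((m + 2 : ℕ) : ℂ) * ((m + 2 - 1 : ℕ) : ℂ)) =
        -(c (j + 1) * ((j + 1 : ℕ) : ℂ) ^ 2) := by
      have h1 : (Nat.factorial m : ℂ) ≠ 0 := by exact_mod_cast Nat.factorial_ne_zero m
      have h2 : (Nat.factorial j : ℂ) ≠ 0 := by exact_mod_cast Nat.factorial_ne_zero j
      have h3 : (j : ℂ) + 1 ≠ 0 := by exact_mod_cast Nat.succ_ne_zero j
      have h4 : (m : ℂ) + 1 ≠ 0 := by exact_mod_cast Nat.succ_ne_zero m
      have h5 : (m : ℂ) + 1 + 1 ≠ 0 := by exact_mod_cast Nat.succ_ne_zero (m + 1)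
      simp only [hc, e1, e2, Nat.factorial_succ,
        show m + 2 - 1 = m + 1 by omega]
      push_cast
      field_simp
      ring
    rw [e1, e2, e3]
    simp
  · have : (k + 1 - 2 * ((k + 1) / 2)) * (k + 1 - 2 * ((k + 1) / 2) - 1) = 0 := by
      rcases Nat.mod_two_eq_zero_or_one (k + 1) with h | h
      · rw [show k + 1 - 2 * ((k + 1) / 2) = 0 by omega, zero_mul]
      · rw [show k + 1 - 2 * ((k + 1) / 2) = 1 by omega]
    rw [← Nat.cast_mul, this]
    simp

/-- `f₁` is congruent to `k z (y ∂f₀/∂z - 2 ∂f₀/∂y)` modulo `f₀`. -/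
theorem D2_f0 (k : ℕ) :
    D2 (k : ℂ) (f0 k) = C ((k + 2) * (k + 1) : ℂ) * X 0 * f0 k +
      C (k : ℂ) * (X 1 * (X 0 * pderiv 1 (f0 k) - 2 * pderiv 0 (f0 k))) := by
  have hE := euler_of_isWeightedHomogeneous (f0_isWeightedHomogeneous k)
  simp only [D2, map_add, map_mul, map_natCast, map_ofNat, map_one]
  push_cast at hE
  linear_combination ((k : MvPolynomial (Fin 2) ℂ) + 2) * X 0 * hE

theorem dvd_f0_sub_C_mul_X_pow {d : MvPolynomial (Fin 2) ℂ} (k : ℕ) (r : ℂ)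
    (hp : d ∣ X 1 - C r * X 0 ^ 2) :
    d ∣ f0 k - C (∑ j ∈ Finset.range ((k + 1) / 2 + 1),
      (-1) ^ j * (Nat.factorial (k + 1) : ℂ) /
      (Nat.factorial (k + 1 - 2 * j) * (Nat.factorial j) ^ 2) * r ^ j) * X 0 ^ (k + 1) := by
  rw [map_sum, Finset.sum_mul, f0, ← Finset.sum_sub_distrib]
  refine Finset.dvd_sum fun j hj => ?_
  have hj' : 2 * j ≤ k + 1 := by have := Finset.mem_range.mp hj; omega
  obtain ⟨m, hm⟩ := Nat.exists_eq_add_of_le hj'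
  have e1 : k + 1 - 2 * j = m := by omega
  have h := (hp.trans (sub_dvd_pow_sub_pow _ _ j)).mul_left
    (C ((-1) ^ j * (Nat.factorial (k + 1) : ℂ) /
      (Nat.factorial (k + 1 - 2 * j) * (Nat.factorial j) ^ 2)) * X 0 ^ m)
  convert! h using 1
  rw [e1, map_mul _ _ (r ^ j), hm, map_pow C r]
  ring

theorem coeff_sum_ne_zero (k : ℕ) : ∑ j ∈ Finset.range ((k + 1) / 2 + 1),
      (-1) ^ j * (Nat.factorial (k + 1) : ℂ) /
      (Nat.factorial (k + 1 - 2 * j) * (Nat.factorial j) ^ 2) * (-(1 / 4)) ^ j ≠ 0 := by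
  have h : ∑ j ∈ Finset.range ((k + 1) / 2 + 1),
      (-1) ^ j * (Nat.factorial (k + 1) : ℂ) /
      (Nat.factorial (k + 1 - 2 * j) * (Nat.factorial j) ^ 2) * (-(1 / 4)) ^ j =
      ((∑ j ∈ Finset.range ((k + 1) / 2 + 1), (Nat.factorial (k + 1) : ℝ) /
      (Nat.factorial (k + 1 - 2 * j) * (Nat.factorial j) ^ 2) * (1 / 4) ^ j : ℝ) : ℂ) := by
    push_cast
    refine Finset.sum_congr rfl fun j _ => ?_
    rw [neg_pow (1 / 4 : ℂ) j]
    have : ((-1 : ℂ) ^ j) * (-1) ^ j = 1 := by rw [← mul_pow]; simp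
    linear_combination ((Nat.factorial (k + 1) : ℂ) /
      (Nat.factorial (k + 1 - 2 * j) * (Nat.factorial j) ^ 2) * (1 / 4) ^ j) * this
  rw [h, Complex.ofReal_ne_zero]
  refine (Finset.sum_pos (fun j _ => ?_) ⟨0, by simp⟩).ne'
  positivity

theorem f0_ne_zero (k : ℕ) : f0 k ≠ 0 := by
  intro h
  obtain ⟨e, h1⟩ := dvd_f0_sub_C_mul_X_pow (d := X 1) k 0 (by simp)
  have h2 := congrArg (MvPolynomial.eval ![1, 0]) h1
  rw [h] at h2
  simp [Finset.sum_range_succ', Nat.factorial_ne_zero] at h2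

theorem isRelPrime_f0_D2_f0 (k : ℕ) (hk : k ≠ 0) : IsRelPrime (f0 k) (D2 (k : ℂ) (f0 k)) := by
  refine WfDvdMonoid.isRelPrime_of_no_irreducible_factors (fun h => f0_ne_zero k h.1)
    fun d hirr hd0 hd1 => ?_
  have hd : Prime d := hirr.prime
  have hz_of (r c : ℂ) (hc : c ≠ 0) (h : d ∣ X 1 - C r * X 0 ^ 2)
      (h' : d ∣ f0 k - C c * X 0 ^ (k + 1)) : d ∣ X 1 ∧ d ∣ X 0 := by
    have h1 : d ∣ C c * X 0 ^ (k + 1) := (dvd_sub_right hd0).mp h'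
    have h2 : d ∣ X 0 := by
      refine hd.dvd_of_dvd_pow ((hd.dvd_or_dvd h1).resolve_left fun hc' => ?_)
      exact hd.not_isUnit (isUnit_of_dvd_unit hc' ((IsUnit.mk0 c hc).map C))
    refine ⟨?_, h2⟩
    have h3 : d ∣ C r * X 0 ^ 2 := (h2.trans (dvd_pow_self _ two_ne_zero)).mul_left _
    simpa using dvd_add h h3
  have not_both (h1 : d ∣ X 1) (h0 : d ∣ X 0) : False := by
    have a1 := hirr.associated_of_dvd X_prime.irreducible h1
    have := a1.symm.dvd.trans h0
    rw [X_dvd_X] at this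
    exact absurd this (by decide)
  have hz : ¬ d ∣ X 1 := by
    intro h
    have h' := dvd_f0_sub_C_mul_X_pow (d := d) k 0 (by simpa using h)
    have := hz_of 0 _ ?_ (by simpa using h) h'
    · exact not_both this.1 this.2
    · simp [Finset.sum_range_succ', Nat.factorial_ne_zero]
  have hu : ¬ d ∣ X 0 ^ 2 + 4 * X 1 := by
    intro h
    have h5 : d ∣ X 1 - C (-(1 / 4)) * X 0 ^ 2 := by
      refine (h.mul_left (C (1 / 4))).trans (dvd_of_eq ?_)
      have e : (4 : MvPolynomial (Fin 2) ℂ) = C 4 := (map_ofNat C 4).symm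
      have e2 : (C (1 / 4) : MvPolynomial (Fin 2) ℂ) * C 4 = 1 := by
        rw [← C_mul]; norm_num
      rw [e, C_neg]
      linear_combination X 1 * e2
    have := hz_of _ _ (coeff_sum_ne_zero k) h5 (dvd_f0_sub_C_mul_X_pow k _ h5)
    exact not_both this.1 this.2
  have hE := euler_of_isWeightedHomogeneous (f0_isWeightedHomogeneous k)
  have hg : d ∣ X 0 * pderiv 1 (f0 k) - 2 * pderiv 0 (f0 k) := by
    rw [D2_f0, dvd_add_right (hd0.mul_left _)] at hd1
    refine (hd.dvd_or_dvd ((hd.dvd_or_dvd hd1).resolve_left fun hc' => ?_)).resolve_left hz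
    exact hd.not_isUnit (isUnit_of_dvd_unit hc'
      ((IsUnit.mk0 (k : ℂ) (Nat.cast_ne_zero.mpr hk)).map C))
  have hy : d ∣ pderiv 0 (f0 k) := by
    refine (hd.dvd_or_dvd (a := X 0 ^ 2 + 4 * X 1) ?_).resolve_left hu
    have e : (X 0 ^ 2 + 4 * X 1) * pderiv 0 (f0 k) =
        (X 0 * ((k + 1 : ℕ) : MvPolynomial (Fin 2) ℂ)) * f0 k -
        2 * X 1 * (X 0 * pderiv 1 (f0 k) - 2 * pderiv 0 (f0 k)) := by
      linear_combination X 0 * hE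
    rw [e]
    exact dvd_sub (hd0.mul_left _) (hg.mul_left _)
  have hzd : d ∣ pderiv 1 (f0 k) := by
    refine (hd.dvd_or_dvd (a := X 0 ^ 2 + 4 * X 1) ?_).resolve_left hu
    have e : (X 0 ^ 2 + 4 * X 1) * pderiv 1 (f0 k) =
        (2 * ((k + 1 : ℕ) : MvPolynomial (Fin 2) ℂ)) * f0 k +
        X 0 * (X 0 * pderiv 1 (f0 k) - 2 * pderiv 0 (f0 k)) := by
      linear_combination 2 * hE
    rw [e]
    exact dvd_add (hd0.mul_left _) (hg.mul_left _)
  exact f0_ne_zero k (eq_zero_of_prime_dvd_pderiv hd hz hu (k + 1) _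
    (f0_isWeightedHomogeneous k) (pderiv_pderiv_f0 k) hd0 hy hzd)

theorem weight_fin_two (d : Fin 2 →₀ ℕ) :
    Finsupp.weight (![1, 2] : Fin 2 → ℕ) d = d 0 + 2 * d 1 := by
  rw [Finsupp.weight_apply, Finsupp.sum_fintype _ _ (by simp), Fin.sum_univ_two]
  simp [mul_comm]

/-- Exponents of weight `n` correspond to the possible exponents of `z`. -/
noncomputable def exponentEquiv (n : ℕ) :
    {d : Fin 2 →₀ ℕ | Finsupp.weight (![1, 2] : Fin 2 → ℕ) d = n} ≃ Fin (n / 2 + 1) where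
  toFun d := ⟨d.1 1, by have := d.2; rw [Set.mem_ofPred_eq, weight_fin_two] at this; omega⟩
  invFun j := ⟨Finsupp.equivFunOnFinite.symm ![n - 2 * j, j], by
    rw [Set.mem_ofPred_eq, weight_fin_two]
    have := j.2
    simp
    omega⟩
  left_inv d := by
    have := d.2
    rw [Set.mem_ofPred_eq, weight_fin_two] at this
    ext i
    fin_cases i
    · simp; omega
    · simp
  right_inv j := by simp

noncomputable def WtEquiv (n : ℕ) : Wt n ≃ₗ[ℂ] (Fin (n / 2 + 1) →₀ ℂ) :=
  (LinearEquiv.ofEq _ _ (weightedHomogeneousSubmodule_eq_finsupp_supported ℂ _ n)).trans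
    ((AddMonoidAlgebra.supportedEquivFinsupp _).trans
      (Finsupp.domLCongr (exponentEquiv n)))

instance finiteDimensional_Wt (n : ℕ) : FiniteDimensional ℂ (Wt n) :=
  Module.Finite.equiv (WtEquiv n).symm

theorem finrank_Wt (n : ℕ) : Module.finrank ℂ (Wt n) = n / 2 + 1 := by
  rw [(WtEquiv n).finrank_eq]
  simp

/-- `Wt` shifted by one, so that `WtPred (n + 1) = Wt n` and `WtPred 0 = ⊥`. -/
noncomputable def WtPred : ℕ → Submodule ℂ (MvPolynomial (Fin 2) ℂ)
  | 0 => ⊥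
  | n + 1 => Wt n

instance finiteDimensional_WtPred (n : ℕ) : FiniteDimensional ℂ (WtPred n) := by
  cases n with
  | zero => exact inferInstanceAs (FiniteDimensional ℂ (⊥ : Submodule ℂ (MvPolynomial (Fin 2) ℂ)))
  | succ n => exact finiteDimensional_Wt n

theorem finrank_WtPred (n : ℕ) : Module.finrank ℂ (WtPred n) = (n + 1) / 2 := by
  cases n with
  | zero => exact finrank_bot ℂ _
  | succ n => exact (finrank_Wt n).trans (by omega)

theorem D2_f0_isWeightedHomogeneous (k : ℕ) :
    (D2 (k : ℂ) (f0 k)).IsWeightedHomogeneous (![1, 2] : Fin 2 → ℕ) (k + 2) := by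
  have hx := isWeightedHomogeneous_X ℂ (![1, 2] : Fin 2 → ℕ) 0
  have hz := isWeightedHomogeneous_X ℂ (![1, 2] : Fin 2 → ℕ) 1
  have hf := f0_isWeightedHomogeneous k
  have hfy : (pderiv 0 (f0 k)).IsWeightedHomogeneous (![1, 2] : Fin 2 → ℕ) k := hf.pderiv rfl
  have hfz : (X 1 * pderiv 1 (f0 k)).IsWeightedHomogeneous (![1, 2] : Fin 2 → ℕ) (k + 1) := by
    have e : X 1 * pderiv 1 (f0 k) = C (1 / 2) *
        (C ((k + 1 : ℕ) : ℂ) * f0 k - X 0 * pderiv 0 (f0 k)) := by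
      have e1 : (C (1 / 2) : MvPolynomial (Fin 2) ℂ) * 2 = 1 := by
        rw [show (2 : MvPolynomial (Fin 2) ℂ) = C 2 from (map_ofNat C 2).symm, ← C_mul]
        norm_num
      have hE := euler_of_isWeightedHomogeneous hf
      rw [map_natCast]
      linear_combination C (1 / 2) * hE - X 1 * pderiv 1 (f0 k) * e1
    rw [e]
    refine IsWeightedHomogeneous.C_mul (IsWeightedHomogeneous.sub (hf.C_mul _) ?_) _
    convert! hx.mul hfy using 1
    simp [add_comm]
  refine IsWeightedHomogeneous.add ?_ ?_
  · have h : ((C ((k : ℂ) + 2) * X 0 ^ 2 - C (2 * (k : ℂ)) * X 1 :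
        MvPolynomial (Fin 2) ℂ)).IsWeightedHomogeneous (![1, 2] : Fin 2 → ℕ) 2 :=
      IsWeightedHomogeneous.sub ((hx.pow 2).C_mul _) (hz.C_mul _)
    convert! h.mul hfy using 1
    omega
  · rw [mul_assoc]
    convert! (hx.C_mul (3 * (k : ℂ) + 4)).mul hfz using 1
    simp
    omega

section Graded

attribute [local instance] weightedGradedAlgebra

theorem weightedHomogeneousComponent_mul_right {a b : MvPolynomial (Fin 2) ℂ} {i : ℕ}
    (hb : b.IsWeightedHomogeneous (![1, 2] : Fin 2 → ℕ) i) (n : ℕ) :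
    weightedHomogeneousComponent (![1, 2] : Fin 2 → ℕ) n (a * b) =
      if i ≤ n then weightedHomogeneousComponent (![1, 2] : Fin 2 → ℕ) (n - i) a * b else 0 := by
  have := DirectSum.coe_decompose_mul_of_right_mem
    (weightedHomogeneousSubmodule ℂ (![1, 2] : Fin 2 → ℕ)) (a := a) (b := b) (i := i) n hb
  simp only [← weightedDecomposition.decompose'_apply]
  exact this

end Graded

theorem component_mem_Jideal {k : ℕ} {p : MvPolynomial (Fin 2) ℂ} (hp : p ∈ Jideal k) (n : ℕ) :
    weightedHomogeneousComponent (![1, 2] : Fin 2 → ℕ) n p ∈ Jideal k := by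
  obtain ⟨a, b, rfl⟩ := Ideal.mem_span_pair.mp hp
  rw [map_add, weightedHomogeneousComponent_mul_right (f0_isWeightedHomogeneous k),
    weightedHomogeneousComponent_mul_right (D2_f0_isWeightedHomogeneous k)]
  refine add_mem ?_ ?_
  · split_ifs
    · exact Ideal.mul_mem_left _ _ (Ideal.subset_span (by simp))
    · exact zero_mem _
  · split_ifs
    · exact Ideal.mul_mem_left _ _ (Ideal.subset_span (by simp))
    · exact zero_mem _

theorem Jideal_inf_Wt_eq_bot {k n : ℕ} (hn : n ≤ k) :
    Submodule.restrictScalars ℂ (Jideal k) ⊓ Wt n = ⊥ := by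
  rw [Submodule.eq_bot_iff]
  rintro p ⟨hp, hpn⟩
  obtain ⟨a, b, hab⟩ := Ideal.mem_span_pair.mp hp
  have h : weightedHomogeneousComponent (![1, 2] : Fin 2 → ℕ) n p = p :=
    IsWeightedHomogeneous.weightedHomogeneousComponent_same hpn
  rw [← h, ← hab, map_add, weightedHomogeneousComponent_mul_right (f0_isWeightedHomogeneous k),
    weightedHomogeneousComponent_mul_right (D2_f0_isWeightedHomogeneous k),
    if_neg (by omega), if_neg (by omega), add_zero]

/-- The map `(a, b) ↦ a f₀ + b f₁` on pairs of total weight `k + 1 + m`. -/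
noncomputable def combMap (k m : ℕ) : (Wt m × WtPred m) →ₗ[ℂ] MvPolynomial (Fin 2) ℂ :=
  ((LinearMap.mulRight ℂ (f0 k)).comp (Wt m).subtype).coprod
    ((LinearMap.mulRight ℂ (D2 (k : ℂ) (f0 k))).comp (WtPred m).subtype)

theorem combMap_apply (k m : ℕ) (a : Wt m) (b : WtPred m) :
    combMap k m (a, b) = a * f0 k + b * D2 (k : ℂ) (f0 k) := by
  simp [combMap]

theorem range_combMap (k m : ℕ) :
    LinearMap.range (combMap k m) =
      Submodule.restrictScalars ℂ (Jideal k) ⊓ Wt (k + 1 + m) := by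
  have hf := f0_isWeightedHomogeneous k
  have hg := D2_f0_isWeightedHomogeneous k
  apply le_antisymm
  · rintro _ ⟨⟨a, b⟩, rfl⟩
    rw [combMap_apply]
    refine ⟨Ideal.mem_span_pair.mpr ⟨a, b, rfl⟩, add_mem ?_ ?_⟩
    · have h := IsWeightedHomogeneous.mul a.2 hf
      rw [add_comm] at h
      exact h
    · obtain ⟨b, hb⟩ := b
      cases m with
      | zero =>
        obtain rfl : b = 0 := hb
        simp
      | succ m =>
        have h := IsWeightedHomogeneous.mul hb hg
        rw [show m + (k + 2) = k + 1 + (m + 1) by omega] at h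
        exact h
  · rintro p ⟨hp, hpn⟩
    obtain ⟨a, b, hab⟩ := Ideal.mem_span_pair.mp hp
    have h : weightedHomogeneousComponent (![1, 2] : Fin 2 → ℕ) (k + 1 + m) p = p :=
      IsWeightedHomogeneous.weightedHomogeneousComponent_same hpn
    rw [← h, ← hab, map_add, weightedHomogeneousComponent_mul_right hf,
      weightedHomogeneousComponent_mul_right hg, if_pos (by omega)]
    cases m with
    | zero =>
      refine ⟨(⟨_, weightedHomogeneousComponent_mem _ a _⟩, 0), ?_⟩
      rw [combMap_apply, if_neg (by omega)]
      simp
    | succ m =>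
      rw [if_pos (by omega), Nat.add_sub_cancel_left,
        show k + 1 + (m + 1) - (k + 2) = m by omega]
      exact ⟨(⟨_, weightedHomogeneousComponent_mem _ _ _⟩,
        ⟨_, weightedHomogeneousComponent_mem _ _ _⟩), combMap_apply _ _ _ _⟩

/-- A nonzero weighted homogeneous polynomial has no nonzero weighted homogeneous multiple of
smaller weight. -/
theorem eq_zero_of_dvd_of_lt {p q : MvPolynomial (Fin 2) ℂ} {i n : ℕ}
    (hp : p.IsWeightedHomogeneous (![1, 2] : Fin 2 → ℕ) i)
    (hq : q.IsWeightedHomogeneous (![1, 2] : Fin 2 → ℕ) n) (h : p ∣ q) (hni : n < i) : q = 0 := by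
  obtain ⟨c, rfl⟩ := h
  rw [← hq.weightedHomogeneousComponent_same, mul_comm p c,
    weightedHomogeneousComponent_mul_right hp, if_neg (by omega)]

theorem combMap_injective {k m : ℕ} (hk : k ≠ 0) (hm : m ≤ k + 1) :
    Function.Injective (combMap k m) := by
  rw [← LinearMap.ker_eq_bot, Submodule.eq_bot_iff]
  rintro ⟨a, b⟩ h
  rw [LinearMap.mem_ker, combMap_apply] at h
  have hdvd : f0 k ∣ (b : MvPolynomial (Fin 2) ℂ) := by
    refine (isRelPrime_f0_D2_f0 k hk).dvd_of_dvd_mul_right ⟨-a, ?_⟩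
    linear_combination h
  have hb : (b : MvPolynomial (Fin 2) ℂ) = 0 := by
    obtain ⟨b, hb⟩ := b
    cases m with
    | zero => exact hb
    | succ m => exact eq_zero_of_dvd_of_lt (f0_isWeightedHomogeneous k) hb hdvd (by omega)
  rw [hb, zero_mul, add_zero] at h
  have ha := (mul_eq_zero.mp h).resolve_right (f0_ne_zero k)
  ext1
  · exact Subtype.ext ha
  · exact Subtype.ext hb

theorem finrank_Jideal_inf_Wt {k n : ℕ} (hk : k ≠ 0) (h1 : k + 1 ≤ n) (h2 : n ≤ 2 * k + 2) :
    Module.finrank ℂ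
      (Submodule.restrictScalars ℂ (Jideal k) ⊓ Wt n : Submodule ℂ (MvPolynomial (Fin 2) ℂ))
      = n - k := by
  obtain ⟨m, rfl⟩ := Nat.exists_eq_add_of_le h1
  rw [← range_combMap, LinearMap.finrank_range_of_inj (combMap_injective hk (by omega)),
    Module.finrank_prod, finrank_Wt, finrank_WtPred]
  omega

theorem Wt_le_Jideal {k : ℕ} (hk : k ≠ 0) (n : ℕ) :
    Wt (2 * k + 1 + n) ≤ Submodule.restrictScalars ℂ (Jideal k) := by
  have base {n : ℕ} (h1 : 2 * k + 1 ≤ n) (h2 : n ≤ 2 * k + 2) :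
      Wt n ≤ Submodule.restrictScalars ℂ (Jideal k) := by
    refine inf_eq_right.mp (Submodule.eq_of_le_of_finrank_eq inf_le_right ?_)
    rw [finrank_Jideal_inf_Wt hk (by omega) h2, finrank_Wt]
    omega
  induction n using Nat.twoStepInduction with
  | zero => exact base le_rfl (by omega)
  | one => exact base (by omega) le_rfl
  | more n ih0 ih1 =>
    intro p hp
    rw [p.as_sum]
    refine sum_mem fun d hd => ?_
    have hw := hp (mem_support_iff.mp hd)
    rw [weight_fin_two] at hw
    have step (i : Fin 2) (m : ℕ) (hi : d i ≠ 0)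
        (hm : d 0 + 2 * d 1 = m + (![1, 2] : Fin 2 → ℕ) i)
        (h : Wt m ≤ Submodule.restrictScalars ℂ (Jideal k)) :
        monomial d (coeff d p) ∈ Submodule.restrictScalars ℂ (Jideal k) := by
      have e : monomial d (coeff d p) =
          X i * monomial (d - Finsupp.single i 1) (coeff d p) := by
        rw [X, monomial_mul, one_mul, add_tsub_cancel_of_le]
        rwa [Finsupp.single_le_iff, Nat.one_le_iff_ne_zero]
      rw [e]
      refine Ideal.mul_mem_left (Jideal k) _ (h (isWeightedHomogeneous_monomial _ _ _ ?_))
      rw [weight_fin_two]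
      fin_cases i <;> simp at hm hi ⊢ <;> omega
    by_cases h1 : d 1 = 0
    · exact step 0 (2 * k + 1 + (n + 1)) (by omega) (by simp; omega) ih1
    · exact step 1 (2 * k + 1 + n) h1 (by simp; omega) ih0

/-- The dimension of the quotient by a subspace `J` that is compatible with a decomposition into
components `W n` (up to a remainder lying in `J`). -/
theorem finrank_quotient_of_components {K V ι : Type*} [Field K] [AddCommGroup V] [Module K V]
    [Fintype ι] (J : Submodule K V) (W : ι → Submodule K V) [∀ n, FiniteDimensional K (W n)]
    (π : ι → V →ₗ[K] V) (hW : ∀ n v, π n v ∈ W n) (hsame : ∀ n, ∀ v ∈ W n, π n v = v)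
    (hne : ∀ n m, m ≠ n → ∀ v ∈ W m, π n v = 0) (hJ : ∀ v, v ∈ J ↔ ∀ n, π n v ∈ J) :
    FiniteDimensional K (V ⧸ J) ∧ Module.finrank K (V ⧸ J) =
      ∑ n, (Module.finrank K (W n) - Module.finrank K (J ⊓ W n : Submodule K V)) := by
  let φ : V →ₗ[K] ((n : ι) → W n ⧸ J.submoduleOf (W n)) :=
    LinearMap.pi fun n => (Submodule.mkQ _).comp ((π n).codRestrict (W n) (hW n))
  have hker : LinearMap.ker φ = J := by
    ext v
    rw [hJ, LinearMap.mem_ker, funext_iff]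
    refine forall_congr' fun n => ?_
    simp only [φ, LinearMap.pi_apply, LinearMap.comp_apply, Pi.zero_apply,
      Submodule.mkQ_apply, Submodule.Quotient.mk_eq_zero]
    rfl
  have hsurj : Function.Surjective φ := by
    intro v
    choose q hq using fun n => Submodule.mkQ_surjective _ (v n)
    refine ⟨∑ n, (q n : V), ?_⟩
    funext n
    rw [← hq n]
    simp only [φ, LinearMap.pi_apply, LinearMap.comp_apply]
    congr 1
    apply Subtype.ext
    rw [LinearMap.codRestrict_apply, map_sum, Finset.sum_eq_single n]
    · exact hsame n _ (q n).2
    · exact fun m _ hm => hne n m hm _ (q m).2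
    · simp
  let e : (V ⧸ J) ≃ₗ[K] ((n : ι) → W n ⧸ J.submoduleOf (W n)) :=
    (Submodule.quotEquivOfEq _ _ hker.symm).trans (φ.quotKerEquivOfSurjective hsurj)
  refine ⟨Module.Finite.equiv e.symm, ?_⟩
  rw [e.finrank_eq, Module.finrank_pi_fintype]
  refine Finset.sum_congr rfl fun n _ => ?_
  have h := Submodule.finrank_quotient_add_finrank (J.submoduleOf (W n))
  rw [← Submodule.finrank_map_subtype_eq (W n) (J.submoduleOf (W n)), Submodule.submoduleOf,
    Submodule.map_comap_subtype, inf_comm] at h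
  rw [← h, Nat.add_sub_cancel, Submodule.submoduleOf]

theorem sum_weight_dim (k : ℕ) :
    ∑ n ∈ Finset.range (2 * k + 1), (n / 2 + 1 - (n - k)) = (k + 1) * (k + 2) / 2 := by
  have h1 : ∀ k : ℕ, ∑ n ∈ Finset.range (2 * k + 1), (n / 2 + 1) = (k + 1) ^ 2 := by
    intro k
    induction k with
    | zero => simp
    | succ k ih =>
      rw [show 2 * (k + 1) + 1 = 2 * k + 1 + 1 + 1 by ring, Finset.sum_range_succ,
        Finset.sum_range_succ, ih, show (2 * k + 1) / 2 = k by omega,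
        show (2 * k + 1 + 1) / 2 = k + 1 by omega]
      ring
  have h2 : (∑ n ∈ Finset.range (2 * k + 1), (n - k)) * 2 = (k + 1) * k := by
    rw [show 2 * k + 1 = k + (k + 1) by ring, Finset.sum_range_add,
      Finset.sum_eq_zero fun n hn => by have := Finset.mem_range.mp hn; omega]
    simp only [Nat.add_sub_cancel_left, zero_add]
    exact Finset.sum_range_id_mul_two (k + 1)
  have h3 : ∑ n ∈ Finset.range (2 * k + 1), (n / 2 + 1 - (n - k)) +
      ∑ n ∈ Finset.range (2 * k + 1), (n - k) = (k + 1) ^ 2 := by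
    rw [← h1, ← Finset.sum_add_distrib]
    refine Finset.sum_congr rfl fun n hn => ?_
    have := Finset.mem_range.mp hn
    omega
  symm
  refine Nat.div_eq_of_eq_mul_left two_pos ?_
  nlinarith

theorem mem_Jideal_iff_components {k : ℕ} (hk : k ≠ 0) (p : MvPolynomial (Fin 2) ℂ) :
    p ∈ Jideal k ↔ ∀ n : Fin (2 * k + 1),
      weightedHomogeneousComponent (![1, 2] : Fin 2 → ℕ) (n : ℕ) p ∈ Jideal k := by
  refine ⟨fun h n => component_mem_Jideal h n, fun h => ?_⟩
  rw [← sum_weightedHomogeneousComponent (![1, 2] : Fin 2 → ℕ) p]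
  refine finsum_induction (· ∈ Jideal k) (zero_mem _) (fun _ _ => add_mem) fun n => ?_
  by_cases hn : n < 2 * k + 1
  · exact h ⟨n, hn⟩
  · obtain ⟨m, rfl⟩ := Nat.exists_eq_add_of_le (not_lt.mp hn)
    exact Wt_le_Jideal hk m (weightedHomogeneousComponent_mem _ p _)

theorem finrank_quotient_Jideal {k : ℕ} (hk : k ≠ 0) :
    FiniteDimensional ℂ (MvPolynomial (Fin 2) ℂ ⧸ Jideal k) ∧
    Module.finrank ℂ (MvPolynomial (Fin 2) ℂ ⧸ Jideal k) = (k + 1) * (k + 2) / 2 := by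
  have hW (n : Fin (2 * k + 1)) (p : MvPolynomial (Fin 2) ℂ) :
      weightedHomogeneousComponent (![1, 2] : Fin 2 → ℕ) (n : ℕ) p ∈ Wt (n : ℕ) :=
    weightedHomogeneousComponent_mem _ p _
  have hsame (n : Fin (2 * k + 1)) (p : MvPolynomial (Fin 2) ℂ) (hp : p ∈ Wt (n : ℕ)) :
      weightedHomogeneousComponent (![1, 2] : Fin 2 → ℕ) (n : ℕ) p = p :=
    IsWeightedHomogeneous.weightedHomogeneousComponent_same hp
  have hne (n m : Fin (2 * k + 1)) (hm : m ≠ n) (p : MvPolynomial (Fin 2) ℂ)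
      (hp : p ∈ Wt (m : ℕ)) : weightedHomogeneousComponent (![1, 2] : Fin 2 → ℕ) (n : ℕ) p = 0 :=
    IsWeightedHomogeneous.weightedHomogeneousComponent_ne (n : ℕ) hp
      (fun h => hm (Fin.ext h.symm))
  obtain ⟨h1, h2⟩ := finrank_quotient_of_components (K := ℂ) (V := MvPolynomial (Fin 2) ℂ)
    (ι := Fin (2 * k + 1)) (Submodule.restrictScalars ℂ (Jideal k)) (fun n => Wt (n : ℕ))
    (fun n => weightedHomogeneousComponent (![1, 2] : Fin 2 → ℕ) (n : ℕ)) hW hsame hne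
    (mem_Jideal_iff_components hk)
  have e := Submodule.Quotient.restrictScalarsEquiv ℂ (Jideal k)
  refine ⟨Module.Finite.equiv e, ?_⟩
  rw [← e.finrank_eq, h2, ← sum_weight_dim,
    ← Fin.sum_univ_eq_sum_range (fun n => n / 2 + 1 - (n - k))]
  refine Finset.sum_congr rfl fun n _ => ?_
  rw [finrank_Wt]
  congr 1
  by_cases hnk : (n : ℕ) ≤ k
  · rw [Jideal_inf_Wt_eq_bot hnk, finrank_bot]
    omega
  · exact finrank_Jideal_inf_Wt hk (by omega) (by omega)

theorem stmt_13 (k : ℕ) (hk : 5 ≤ k) :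
    FiniteDimensional ℂ (MvPolynomial (Fin 2) ℂ ⧸ Jideal k) ∧
    Module.finrank ℂ (MvPolynomial (Fin 2) ℂ ⧸ Jideal k) = (k + 1) * (k + 2) / 2 ∧
    (∀ n : ℕ, n ≤ k → Submodule.restrictScalars ℂ (Jideal k) ⊓ Wt n = ⊥) ∧
    (∀ n : ℕ, k + 1 ≤ n → n ≤ 2 * k + 2 →
      Module.finrank ℂ
        (Submodule.restrictScalars ℂ (Jideal k) ⊓ Wt n : Submodule ℂ (MvPolynomial (Fin 2) ℂ))
        = n - k) ∧
    (∀ n : ℕ, 2 * k + 1 ≤ n → Wt n ≤ Submodule.restrictScalars ℂ (Jideal k)) := by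
  have hk0 : k ≠ 0 := by omega
  obtain ⟨h1, h2⟩ := finrank_quotient_Jideal hk0
  refine ⟨h1, h2, fun n hn => Jideal_inf_Wt_eq_bot hn,
    fun n h1 h2 => finrank_Jideal_inf_Wt hk0 h1 h2, fun n hn => ?_⟩
  obtain ⟨m, rfl⟩ := Nat.exists_eq_add_of_le hn
  exact Wt_le_Jideal hk0 m
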